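/- arXiv:1108.4873 — 3 statements merged into one kernel-verified Lean document; each statement's English description precedes it below -/
import Mathlib

section
/- The characteristic function is a morphism of the oriented graphs of almost self-dual modules: if Q' ⊆ Q and T' ⊆ T are almost self-dual ℤ_p-submodules of H, then for every g ∈ GL(α+km, ℚ_p) one has χ_g(Q',T') ⊆ χ_g(Q,T) (and both χ_g(Q',T') and χ_g(Q,T) are almost self-dual submodules of (V⊕V, B^⊖)). -/
open scoped BigOperators

/-- The symplectic coordinate space `ℚ_p^n ⊕ ℚ_p^n`, written as pairs `(x⁺, x⁻)`. -/
abbrev SpV (p : ℕ) [Fact p.Prime] (n : ℕ) := (Fin n → ℚ_[p]) × (Fin n → ℚ_[p])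

/-- The standard skew-symmetric bilinear form `B(x, y) = Σ_s (x_s⁺ y_s⁻ − x_s⁻ y_s⁺)`. -/
noncomputable def Bform (p : ℕ) [Fact p.Prime] (n : ℕ) (x y : SpV p n) : ℚ_[p] :=
  ∑ s, (x.1 s * y.2 s - x.2 s * y.1 s)

/-- The form `B^⊖(u ⊕ v, u' ⊕ v') = B_V(u, u') − B_V(v, v')` on `V ⊕ V`. -/
noncomputable def Bminus (p : ℕ) [Fact p.Prime] (α : ℕ) (z w : SpV p α × SpV p α) : ℚ_[p] :=
  Bform p α z.1 w.1 - Bform p α z.2 w.2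

/-- The dual module `P^⊥⊥ = {w : B(v,w) ∈ ℤ_p for all v ∈ P}` of a set `P` with respect to a
bilinear form `B` (membership in `ℤ_p` expressed as `‖·‖ ≤ 1`). -/
def dualMod (p : ℕ) [Fact p.Prime] {X : Type*} (B : X → X → ℚ_[p]) (P : Set X) : Set X :=
  {w | ∀ v ∈ P, ‖B v w‖ ≤ 1}

/-- A set is *self-dual* with respect to `B` if it coincides with its dual module. -/
def IsSelfDual (p : ℕ) [Fact p.Prime] {X : Type*} (B : X → X → ℚ_[p]) (P : Set X) : Prop :=
  dualMod p B P = P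

/-- A `ℤ_p`-submodule of a `ℚ_p`-vector space: a set containing `0`, closed under addition
and under multiplication by p-adic integers (scalars of norm at most 1). -/
def IsZpSubmodule (p : ℕ) [Fact p.Prime] {X : Type*} [AddCommGroup X] [Module ℚ_[p] X]
    (P : Set X) : Prop :=
  (0 : X) ∈ P ∧ (∀ x ∈ P, ∀ y ∈ P, x + y ∈ P) ∧
    ∀ c : ℚ_[p], ‖c‖ ≤ 1 → ∀ x ∈ P, c • x ∈ P

/-- The index set `{1,…,α} ⊔ ({1,…,k} × {1,…,m})` for matrices in `GL(α + km, ℚ_p)`. -/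
abbrev BigIx (α k m : ℕ) := Fin α ⊕ (Fin k × Fin m)

/-- Glue a vector `u ∈ ℚ_p^α` and a tuple `x = (x_1, …, x_k)` with `x_j ∈ ℚ_p^m` into a single
vector indexed by `BigIx α k m`. -/
def glue {p α k m : ℕ} [Fact p.Prime] (u : Fin α → ℚ_[p]) (x : Fin k → Fin m → ℚ_[p]) :
    BigIx α k m → ℚ_[p] :=
  Sum.elim u fun js => x js.1 js.2

/-- The slice of a tuple `x = (x⁺, x⁻)` (with `x_j^± ∈ ℚ_p^m`) at coordinate `s`, as an
element of `H = ℚ_p^k ⊕ ℚ_p^k`. -/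
def tupleSlice {p k m : ℕ} [Fact p.Prime]
    (xp xm : Fin k → Fin m → ℚ_[p]) (s : Fin m) : SpV p k :=
  (fun j => xp j s, fun j => xm j s)

/-- **The characteristic function** `χ_g(Q, T)` of `g ∈ GL(α + km, ℚ_p)` (viewed as a matrix
`M` on the index set `BigIx α k m`): the set of all `(u⁺ ⊕ u⁻) ⊕ (v⁺ ⊕ v⁻) ∈ V ⊕ V` for which
there exist `x ∈ Q ⊗ ℤ_p^m` and `y ∈ T ⊗ ℤ_p^m` with `(v⁺, y⁺) = g (u⁺, x⁺)` and
`(u⁻, x⁻) = gᵗ (v⁻, y⁻)`. -/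
def chiM (p α k m : ℕ) [Fact p.Prime]
    (M : Matrix (BigIx α k m) (BigIx α k m) ℚ_[p]) (Q T : Set (SpV p k)) :
    Set (SpV p α × SpV p α) :=
  {uv | ∃ xp xm yp ym : Fin k → Fin m → ℚ_[p],
    (∀ s : Fin m, tupleSlice xp xm s ∈ Q) ∧
    (∀ s : Fin m, tupleSlice yp ym s ∈ T) ∧
    glue uv.2.1 yp = M.mulVec (glue uv.1.1 xp) ∧
    glue uv.1.2 xm = M.transpose.mulVec (glue uv.2.2 ym)}

/-- A set `P` is *almost self-dual* with respect to `B` if it contains a self-dual submodule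
and `B(v, w) ∈ p^{-1} ℤ_p` (i.e. `‖B(v,w)‖ ≤ p`) for all `v, w ∈ P`. -/
def IsAlmostSelfDual (p : ℕ) [Fact p.Prime] {X : Type*}
    (B : X → X → ℚ_[p]) (P : Set X) : Prop :=
  (∃ S : Set X, S ⊆ P ∧ IsSelfDual p B S) ∧ ∀ v ∈ P, ∀ w ∈ P, ‖B v w‖ ≤ (p : ℝ)

section Separation

variable {p : ℕ} [Fact p.Prime]

/-- If each constraint `‖a i + c * b i‖ ≤ 1` implies those with a smaller coefficient `b j`, then all
constraints have a common solution `c`. -/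
lemma exists_forall_norm_add_mul_le_one {ι : Type*} (a b : ι → ℚ_[p])
    (h0 : ∀ i, b i = 0 → ‖a i‖ ≤ 1)
    (hdir : ∀ i j c, b i ≠ 0 → ‖b j‖ ≤ ‖b i‖ → ‖a i + c * b i‖ ≤ 1 → ‖a j + c * b j‖ ≤ 1) :
    ∃ c, ∀ i, ‖a i + c * b i‖ ≤ 1 := by
  by_cases hne : ∃ i, b i ≠ 0
  swap
  · push Not at hne
    exact ⟨0, fun i => by simpa using h0 i (hne i)⟩
  obtain ⟨i₀, hi₀⟩ := hne
  let K : {i // b i ≠ 0} → Set ℚ_[p] := fun i => {c | ‖a i + c * b i‖ ≤ 1}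
  have hclosed (i) : IsClosed (K i) :=
    isClosed_le (by fun_prop) continuous_const
  have hcompact (i) : IsCompact (K i) := by
    refine Metric.isCompact_of_isClosed_isBounded (hclosed i) ?_
    refine (Metric.isBounded_closedBall (x := -(a i / b i)) (r := ‖(b i)⁻¹‖)).subset ?_
    intro c hc
    have hb := i.2
    have hrw : c - -(a i / b i) = (a i + c * b i) * (b i)⁻¹ := by field_simp; ring
    rw [Metric.mem_closedBall, dist_eq_norm, hrw, norm_mul]
    exact mul_le_of_le_one_left (norm_nonneg _) hc
  have hnonempty (i) : (K i).Nonempty := by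
    refine ⟨-(a i / b i), ?_⟩
    have hb := i.2
    have hrw : a i + -(a i / b i) * b i = 0 := by field_simp; ring
    simp only [K, Set.mem_ofPred_eq, hrw, norm_zero, zero_le_one]
  have hdirected : Directed (· ⊇ ·) K := by
    intro i j
    rcases le_total ‖b i‖ ‖b j‖ with h | h
    · exact ⟨j, fun c hc => hdir j i c j.2 h hc, subset_rfl⟩
    · exact ⟨i, subset_rfl, fun c hc => hdir i j c i.2 h hc⟩
  have : Nonempty {i // b i ≠ 0} := ⟨⟨i₀, hi₀⟩⟩
  obtain ⟨c, hc⟩ := IsCompact.nonempty_iInter_of_directed_nonempty_isCompact_isClosed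
    K hdirected hnonempty hcompact hclosed
  rw [Set.mem_iInter] at hc
  refine ⟨c, fun i => ?_⟩
  by_cases hi : b i = 0
  · simpa [hi] using h0 i hi
  · exact hc ⟨i, hi⟩

variable {X : Type*} [AddCommGroup X] [Module ℚ_[p] X]

lemma IsZpSubmodule.sub_mem {P : Set X} (hP : IsZpSubmodule p P) {x y : X} (hx : x ∈ P)
    (hy : y ∈ P) : x - y ∈ P := by
  rw [sub_eq_add_neg, ← neg_one_smul ℚ_[p] y]
  exact hP.2.1 x hx _ (hP.2.2 _ (by simp) y hy)

/-- Extension of a functional which is integral on `P ∩ Y` to one which is integral on `P`. -/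
lemma IsZpSubmodule.exists_integral_extension [FiniteDimensional ℚ_[p] X] {P : Set X}
    (hP : IsZpSubmodule p P) (Y : Submodule ℚ_[p] X) (f : X →ₗ[ℚ_[p]] ℚ_[p])
    (hf : ∀ z ∈ P, z ∈ Y → ‖f z‖ ≤ 1) :
    ∃ F : X →ₗ[ℚ_[p]] ℚ_[p], (∀ y ∈ Y, F y = f y) ∧ ∀ z ∈ P, ‖F z‖ ≤ 1 := by
  induction Y using IsNoetherian.induction generalizing f with
  | hgt Y ih =>
  by_cases hY : Y = ⊤
  · exact ⟨f, fun _ _ => rfl, fun z hz => hf z hz (hY ▸ Submodule.mem_top)⟩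
  obtain ⟨e, -, he⟩ := SetLike.exists_of_lt (lt_top_iff_ne_top.mpr hY)
  obtain ⟨φ, hφe, hφY⟩ := Submodule.exists_le_ker_of_notMem he
  have hφ (y) (hy : y ∈ Y) : φ y = 0 := hφY hy
  let Y' := Y ⊔ Submodule.span ℚ_[p] {e}
  have hlt : Y < Y' := by
    refine lt_of_le_of_ne le_sup_left fun h => he ?_
    rw [h]
    exact Submodule.mem_sup_right (Submodule.mem_span_singleton_self e)
  have hker (z) (hz : z ∈ Y') (h : φ z = 0) : z ∈ Y := by
    obtain ⟨y, hy, w, hw, rfl⟩ := Submodule.mem_sup.mp hz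
    obtain ⟨t, rfl⟩ := Submodule.mem_span_singleton.mp hw
    have ht : t = 0 := by simpa [hφ y hy, hφe] using h
    simpa [ht] using hy
  obtain ⟨c, hc⟩ := exists_forall_norm_add_mul_le_one
    (fun z : {z // z ∈ P ∧ z ∈ Y'} => f z) (fun z => φ z)
    (fun z hz => hf z z.2.1 (hker z z.2.2 hz)) (by
      rintro ⟨z, hzP, hzY⟩ ⟨z', hzP', hzY'⟩ c (hz : φ z ≠ 0) (hle : ‖φ z'‖ ≤ ‖φ z‖)
        (h : ‖f z + c * φ z‖ ≤ 1)
      change ‖f z' + c * φ z'‖ ≤ 1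
      have hr : ‖φ z' / φ z‖ ≤ 1 := by
        rw [norm_div]
        exact div_le_one_of_le₀ hle (norm_nonneg _)
      have hw : ‖f (z' - (φ z' / φ z) • z)‖ ≤ 1 := by
        refine hf _ (hP.sub_mem hzP' (hP.2.2 _ hr z hzP))
          (hker _ (Y'.sub_mem hzY' (Y'.smul_mem _ hzY)) ?_)
        simp [hz]
      have hsum : f z' + c * φ z' =
          f (z' - (φ z' / φ z) • z) + (φ z' / φ z) * (f z + c * φ z) := by
        simp only [map_sub, map_smul, smul_eq_mul]
        field_simp
        ring
      rw [hsum]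
      refine (Padic.nonarchimedean _ _).trans (max_le hw ?_)
      rw [norm_mul]
      exact mul_le_one₀ hr (norm_nonneg _) h)
  obtain ⟨F, hFY, hFP⟩ := ih Y' hlt (f + c • φ) fun z hz hzY => hc ⟨z, hz, hzY⟩
  refine ⟨F, fun y hy => ?_, hFP⟩
  simp [hFY y (hlt.le hy), hφ y hy]

/-- A point outside a `ℤ_p`-submodule of a finite-dimensional space is separated from it by a
linear functional. -/
lemma IsZpSubmodule.exists_separating [FiniteDimensional ℚ_[p] X] {P : Set X}
    (hP : IsZpSubmodule p P) {x : X} (hx : x ∉ P) :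
    ∃ F : X →ₗ[ℚ_[p]] ℚ_[p], (∀ z ∈ P, ‖F z‖ ≤ 1) ∧ 1 < ‖F x‖ := by
  have hp : (1 : ℝ) < p := by exact_mod_cast (Fact.out : p.Prime).one_lt
  have hx0 : x ≠ 0 := fun h => hx (h ▸ hP.1)
  obtain ⟨φ, hφ⟩ := Module.Projective.exists_dual_eq_one ℚ_[p] hx0
  obtain ⟨F, hF, hFP⟩ := hP.exists_integral_extension (Submodule.span ℚ_[p] {x})
    ((p : ℚ_[p])⁻¹ • φ) (by
      intro z hz hzx
      obtain ⟨t, rfl⟩ := Submodule.mem_span_singleton.mp hzx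
      have ht : ‖t‖ < 1 := by
        by_contra! h
        have ht0 : t ≠ 0 := by
          rintro rfl
          simp at h
          linarith
        refine hx ?_
        have := hP.2.2 t⁻¹ (by rw [norm_inv]; exact inv_le_one_of_one_le₀ h) _ hz
        rwa [inv_smul_smul₀ ht0] at this
      have ht' : ‖t‖ ≤ (p : ℝ) ^ (-1 : ℤ) := by
        rw [Padic.norm_le_pow_iff_norm_lt_pow_add_one]
        simpa using ht
      have hnorm : ‖t * (p : ℚ_[p])⁻¹‖ = p * ‖t‖ := by simp [mul_comm]
      simp only [LinearMap.smul_apply, LinearMap.map_smul, hφ, smul_eq_mul, mul_one,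
        mul_comm _ t, hnorm]
      calc (p : ℝ) * ‖t‖ ≤ p * (p : ℝ) ^ (-1 : ℤ) := by gcongr
        _ = 1 := by rw [zpow_neg_one]; exact mul_inv_cancel₀ (by positivity))
  refine ⟨F, hFP, ?_⟩
  rw [hF x (Submodule.mem_span_singleton_self x)]
  simpa [hφ] using hp

end Separation

section Forms

variable {p : ℕ} [Fact p.Prime]

lemma Bform_swap {n : ℕ} (x y : SpV p n) : Bform p n x y = -Bform p n y x := by
  simp only [Bform, ← Finset.sum_neg_distrib]
  exact Finset.sum_congr rfl fun s _ => by ring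

lemma IsSelfDual.isZpSubmodule {n : ℕ} {S : Set (SpV p n)} (hS : IsSelfDual p (Bform p n) S) :
    IsZpSubmodule p S := by
  have hadd (v x y : SpV p n) : Bform p n v (x + y) = Bform p n v x + Bform p n v y := by
    simp only [Bform, ← Finset.sum_add_distrib, Prod.fst_add, Prod.snd_add, Pi.add_apply]
    exact Finset.sum_congr rfl fun s _ => by ring
  have hsmul (c : ℚ_[p]) (v x : SpV p n) : Bform p n v (c • x) = c * Bform p n v x := by
    simp only [Bform, Finset.mul_sum, Prod.smul_fst, Prod.smul_snd, Pi.smul_apply, smul_eq_mul]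
    exact Finset.sum_congr rfl fun s _ => by ring
  rw [← hS]
  refine ⟨fun v _ => by simp [Bform], fun x hx y hy v hv => ?_, fun c hc x hx v hv => ?_⟩
  · rw [hadd]
    exact (Padic.nonarchimedean _ _).trans (max_le (hx v hv) (hy v hv))
  · rw [hsmul, norm_mul]
    exact mul_le_one₀ hc (norm_nonneg _) (hx v hv)

lemma IsSelfDual.mem_of_forall_left {n : ℕ} {S : Set (SpV p n)}
    (hS : IsSelfDual p (Bform p n) S) {w : SpV p n}
    (h : ∀ v ∈ S, ‖Bform p n w v‖ ≤ 1) : w ∈ S := by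
  rw [← hS]
  intro v hv
  rw [Bform_swap, norm_neg]
  exact h v hv

variable {α k m : ℕ}

lemma exists_eq_glue (ξ : BigIx α k m → ℚ_[p]) : ∃ u x, ξ = glue u x :=
  ⟨fun i => ξ (Sum.inl i), fun j s => ξ (Sum.inr (j, s)), by ext (i | i) <;> rfl⟩

lemma glue_eq_add (u : Fin α → ℚ_[p]) (x : Fin k → Fin m → ℚ_[p]) :
    glue u x = glue u 0 + glue 0 x := by
  ext (i | i) <;> simp [glue]

lemma glue_zero_add (x y : Fin k → Fin m → ℚ_[p]) :
    glue (0 : Fin α → ℚ_[p]) (x + y) = glue 0 x + glue 0 y := by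
  ext (i | i) <;> simp [glue]

lemma glue_zero_smul (c : ℚ_[p]) (x : Fin k → Fin m → ℚ_[p]) :
    glue (0 : Fin α → ℚ_[p]) (c • x) = c • glue 0 x := by
  ext (i | i) <;> simp [glue]

lemma glue_zero_zero : (glue 0 0 : BigIx α k m → ℚ_[p]) = 0 := by
  ext (i | i) <;> simp [glue]

/-- The symplectic form on glued vectors is the sum of the forms of the parts. -/
lemma glue_dotProduct_sub (u u' : SpV p α) (xp xm xp' xm' : Fin k → Fin m → ℚ_[p]) :
    glue u.1 xp ⬝ᵥ glue u'.2 xm' - glue u.2 xm ⬝ᵥ glue u'.1 xp' =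
      Bform p α u u' + ∑ s, Bform p k (tupleSlice xp xm s) (tupleSlice xp' xm' s) := by
  simp only [dotProduct, Fintype.sum_sum_type, Fintype.sum_prod_type_right, glue, Sum.elim_inl,
    Sum.elim_inr, Bform, tupleSlice, Finset.sum_sub_distrib]
  ring

/-- The form `B^⊖` on the characteristic function is the difference of the forms on the
witnesses. -/
lemma Bminus_eq_sum (M : Matrix (BigIx α k m) (BigIx α k m) ℚ_[p]) {z w : SpV p α × SpV p α}
    {xp xm yp ym xp' xm' yp' ym' : Fin k → Fin m → ℚ_[p]}
    (h₁ : glue z.2.1 yp = M.mulVec (glue z.1.1 xp))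
    (h₂ : glue z.1.2 xm = M.transpose.mulVec (glue z.2.2 ym))
    (h₁' : glue w.2.1 yp' = M.mulVec (glue w.1.1 xp'))
    (h₂' : glue w.1.2 xm' = M.transpose.mulVec (glue w.2.2 ym')) :
    Bminus p α z w = ∑ s, (Bform p k (tupleSlice yp ym s) (tupleSlice yp' ym' s) -
      Bform p k (tupleSlice xp xm s) (tupleSlice xp' xm' s)) := by
  have hx := glue_dotProduct_sub z.1 w.1 xp xm xp' xm'
  have hy := glue_dotProduct_sub z.2 w.2 yp ym yp' ym'
  rw [h₂, h₂', Matrix.mulVec_transpose, Matrix.mulVec_transpose, dotProduct_comm,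
    ← Matrix.dotProduct_mulVec, ← Matrix.dotProduct_mulVec, ← h₁, ← h₁',
    dotProduct_comm (glue w.2.2 ym')] at hx
  rw [Bminus, Finset.sum_sub_distrib]
  linear_combination hy - hx

lemma norm_Bminus_le (M : Matrix (BigIx α k m) (BigIx α k m) ℚ_[p]) {Q T : Set (SpV p k)}
    {r : ℝ} (hr : 0 ≤ r) (hQ : ∀ v ∈ Q, ∀ w ∈ Q, ‖Bform p k v w‖ ≤ r)
    (hT : ∀ v ∈ T, ∀ w ∈ T, ‖Bform p k v w‖ ≤ r) {z w : SpV p α × SpV p α}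
    (hz : z ∈ chiM p α k m M Q T) (hw : w ∈ chiM p α k m M Q T) : ‖Bminus p α z w‖ ≤ r := by
  obtain ⟨xp, xm, yp, ym, hx, hy, h₁, h₂⟩ := hz
  obtain ⟨xp', xm', yp', ym', hx', hy', h₁', h₂'⟩ := hw
  rw [Bminus_eq_sum M h₁ h₂ h₁' h₂']
  refine IsUltrametricDist.norm_sum_le_of_forall_le_of_nonneg hr fun s _ => ?_
  rw [sub_eq_add_neg]
  refine (Padic.nonarchimedean _ _).trans (max_le (hT _ (hy s) _ (hy' s)) ?_)
  rw [norm_neg]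
  exact hQ _ (hx s) _ (hx' s)

lemma chiM_mono (M : Matrix (BigIx α k m) (BigIx α k m) ℚ_[p]) {Q Q' T T' : Set (SpV p k)}
    (hQ : Q' ⊆ Q) (hT : T' ⊆ T) : chiM p α k m M Q' T' ⊆ chiM p α k m M Q T := by
  rintro z ⟨xp, xm, yp, ym, hx, hy, h⟩
  exact ⟨xp, xm, yp, ym, fun s => hQ (hx s), fun s => hT (hy s), h⟩

/-- The defects of the equations defining `chiM` at the zero vector, over all `x ∈ Q ⊗ ℤ_p^m` and
`y ∈ T ⊗ ℤ_p^m`. -/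
def chiDefect (M : Matrix (BigIx α k m) (BigIx α k m) ℚ_[p]) (Q T : Set (SpV p k)) :
    Set ((BigIx α k m → ℚ_[p]) × (BigIx α k m → ℚ_[p])) :=
  {z | ∃ xp xm yp ym : Fin k → Fin m → ℚ_[p],
    (∀ s, tupleSlice xp xm s ∈ Q) ∧ (∀ s, tupleSlice yp ym s ∈ T) ∧
    z = (glue 0 yp - M.mulVec (glue 0 xp), glue 0 xm - M.transpose.mulVec (glue 0 ym))}

lemma isZpSubmodule_chiDefect (M : Matrix (BigIx α k m) (BigIx α k m) ℚ_[p])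
    {Q T : Set (SpV p k)} (hQ : IsZpSubmodule p Q) (hT : IsZpSubmodule p T) :
    IsZpSubmodule p (chiDefect M Q T) := by
  refine ⟨⟨0, 0, 0, 0, fun _ => hQ.1, fun _ => hT.1, ?_⟩, ?_, ?_⟩
  · simp only [glue_zero_zero, Matrix.mulVec_zero, sub_zero]
    rfl
  · rintro _ ⟨xp, xm, yp, ym, hx, hy, rfl⟩ _ ⟨xp', xm', yp', ym', hx', hy', rfl⟩
    refine ⟨xp + xp', xm + xm', yp + yp', ym + ym', fun s => hQ.2.1 _ (hx s) _ (hx' s),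
      fun s => hT.2.1 _ (hy s) _ (hy' s), ?_⟩
    simp only [glue_zero_add, Matrix.mulVec_add, Prod.mk_add_mk]
    congr 1 <;> abel
  · rintro c hc _ ⟨xp, xm, yp, ym, hx, hy, rfl⟩
    refine ⟨c • xp, c • xm, c • yp, c • ym, fun s => hQ.2.2 c hc _ (hx s),
      fun s => hT.2.2 c hc _ (hy s), ?_⟩
    simp only [glue_zero_smul, Matrix.mulVec_smul, Prod.smul_mk, smul_sub]

lemma exists_dotProduct_representation {ι : Type*} [Fintype ι]
    (F : ((ι → ℚ_[p]) × (ι → ℚ_[p])) →ₗ[ℚ_[p]] ℚ_[p]) :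
    ∃ η ξ : ι → ℚ_[p], ∀ a b, F (a, b) = η ⬝ᵥ a + ξ ⬝ᵥ b := by
  classical
  refine ⟨fun i => F (Pi.single i 1, 0), fun i => F (0, Pi.single i 1), fun a b => ?_⟩
  have h₁ := (F ∘ₗ LinearMap.inl _ _ _).pi_apply_eq_sum_univ a
  have h₂ := (F ∘ₗ LinearMap.inr _ _ _).pi_apply_eq_sum_univ b
  have hab : F (a, b) = F (a, 0) + F (0, b) := by rw [← map_add]; simp
  simp only [LinearMap.comp_apply, LinearMap.inl_apply, LinearMap.inr_apply, smul_eq_mul] at h₁ h₂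
  rw [hab, h₁, h₂]
  simp only [dotProduct]
  congr 1 <;> refine Finset.sum_congr rfl fun i _ => ?_ <;> rw [mul_comm] <;> congr <;> ext j <;>
    simp [Pi.single_apply, eq_comm]

/-- The tuple whose slice at `s` is `q` and whose other slices vanish. -/
lemma exists_tupleSlice_single {Q : Set (SpV p k)} (h0 : (0 : SpV p k) ∈ Q) {q : SpV p k}
    (hq : q ∈ Q) (s : Fin m) : ∃ qp qm : Fin k → Fin m → ℚ_[p],
      (∀ t, tupleSlice qp qm t ∈ Q) ∧ tupleSlice qp qm s = q ∧
      ∀ t, t ≠ s → tupleSlice qp qm t = 0 := by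
  refine ⟨fun j t => if t = s then q.1 j else 0, fun j t => if t = s then q.2 j else 0, ?_⟩
  have hs : tupleSlice (fun j t => if t = s then q.1 j else 0)
      (fun j t => if t = s then q.2 j else 0) s = q := by simp [tupleSlice]
  have ht (t) (h : t ≠ s) : tupleSlice (fun j t => if t = s then q.1 j else 0)
      (fun j t => if t = s then q.2 j else 0) t = 0 := by
    simp only [tupleSlice, if_neg h]
    rfl
  refine ⟨fun t => ?_, hs, ht⟩
  by_cases h : t = s
  · rwa [h, hs]
  · rwa [ht t h]

lemma tupleSlice_mem_of_forall {Q : Set (SpV p k)} (hQ : IsSelfDual p (Bform p k) Q)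
    (u : SpV p α) {xp xm : Fin k → Fin m → ℚ_[p]}
    (h : ∀ qp qm : Fin k → Fin m → ℚ_[p], (∀ s, tupleSlice qp qm s ∈ Q) →
      ‖glue u.1 xp ⬝ᵥ glue 0 qm - glue u.2 xm ⬝ᵥ glue 0 qp‖ ≤ 1) (s : Fin m) :
    tupleSlice xp xm s ∈ Q := by
  refine hQ.mem_of_forall_left fun q hq => ?_
  obtain ⟨qp, qm, hmem, hs, ht⟩ := exists_tupleSlice_single hQ.isZpSubmodule.1 hq s
  have hle := h qp qm hmem
  have hform := glue_dotProduct_sub u 0 xp xm qp qm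
  rw [Finset.sum_eq_single s (fun t _ hts => by rw [ht t hts]; simp [Bform]) (by simp), hs] at hform
  have h0 : Bform p α u 0 = 0 := by simp [Bform]
  rw [h0, zero_add] at hform
  rw [← hform]
  exact hle

theorem isSelfDual_chiM (M : Matrix (BigIx α k m) (BigIx α k m) ℚ_[p]) {Q T : Set (SpV p k)}
    (hQ : IsSelfDual p (Bform p k) Q) (hT : IsSelfDual p (Bform p k) T) :
    IsSelfDual p (Bminus p α) (chiM p α k m M Q T) := by
  have hbound {S : Set (SpV p k)} (hS : IsSelfDual p (Bform p k) S) :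
      ∀ v ∈ S, ∀ w ∈ S, ‖Bform p k v w‖ ≤ 1 := by
    intro v hv w hw
    rw [← hS] at hw
    exact hw v hv
  refine Set.Subset.antisymm (fun w hw => ?_)
    fun w hw z hz => norm_Bminus_le M zero_le_one (hbound hQ) (hbound hT) hz hw
  suffices hmem : (M.mulVec (glue w.1.1 0) - glue w.2.1 0,
      M.transpose.mulVec (glue w.2.2 0) - glue w.1.2 0) ∈ chiDefect M Q T by
    obtain ⟨xp, xm, yp, ym, hx, hy, h⟩ := hmem
    obtain ⟨h₁, h₂⟩ := Prod.mk.inj h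
    refine ⟨xp, xm, yp, ym, hx, hy, ?_, ?_⟩
    · rw [glue_eq_add w.2.1, glue_eq_add w.1.1, Matrix.mulVec_add]
      linear_combination -h₁
    · rw [glue_eq_add w.1.2, glue_eq_add w.2.2, Matrix.mulVec_add]
      linear_combination -h₂
  by_contra hnot
  obtain ⟨F, hF, hlt⟩ := (isZpSubmodule_chiDefect M hQ.isZpSubmodule
    hT.isZpSubmodule).exists_separating hnot
  obtain ⟨η, ξ, hrep⟩ := exists_dotProduct_representation F
  obtain ⟨a, xp, hξ⟩ := exists_eq_glue ξ
  obtain ⟨b, ym, hη⟩ := exists_eq_glue η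
  obtain ⟨a', yp, hMξ⟩ := exists_eq_glue (M.mulVec ξ)
  obtain ⟨b', xm, hMη⟩ := exists_eq_glue (M.transpose.mulVec η)
  have hηM (v) : η ⬝ᵥ M.mulVec v = glue b' xm ⬝ᵥ v := by
    rw [Matrix.dotProduct_mulVec, ← Matrix.mulVec_transpose, hMη]
  have hξM (v) : ξ ⬝ᵥ M.transpose.mulVec v = glue a' yp ⬝ᵥ v := by
    rw [Matrix.dotProduct_mulVec, Matrix.vecMul_transpose, hMξ]
  have hz : ((a, b'), (a', b)) ∈ chiM p α k m M Q T := by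
    refine ⟨xp, xm, yp, ym, tupleSlice_mem_of_forall hQ (a, b') fun qp qm hq => ?_,
      tupleSlice_mem_of_forall hT (a', b) fun qp qm hq => ?_, ?_, ?_⟩
    · have h := hF _ ⟨qp, qm, 0, 0, hq, fun _ => hT.isZpSubmodule.1, rfl⟩
      rw [hrep, dotProduct_sub, dotProduct_sub, hηM, hξM, glue_zero_zero, hξ] at h
      have heq : glue a xp ⬝ᵥ glue 0 qm - glue b' xm ⬝ᵥ glue 0 qp =
          η ⬝ᵥ 0 - glue b' xm ⬝ᵥ glue 0 qp + (glue a xp ⬝ᵥ glue 0 qm - glue a' yp ⬝ᵥ 0) := by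
        simp only [dotProduct_zero]
        ring
      rwa [heq]
    · have h := hF _ ⟨0, 0, qp, qm, fun _ => hQ.isZpSubmodule.1, hq, rfl⟩
      rw [hrep, dotProduct_sub, dotProduct_sub, hηM, hξM, glue_zero_zero, hη, ← norm_neg] at h
      have heq : glue a' yp ⬝ᵥ glue 0 qm - glue b ym ⬝ᵥ glue 0 qp =
          -(glue b ym ⬝ᵥ glue 0 qp - glue b' xm ⬝ᵥ 0 + (ξ ⬝ᵥ 0 - glue a' yp ⬝ᵥ glue 0 qm)) := by
        simp only [dotProduct_zero]
        ring
      rwa [heq]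
    · rw [← hMξ, hξ]
    · rw [← hMη, hη]
  have h₁ := glue_dotProduct_sub (a, b') w.1 xp xm 0 0
  have h₂ := glue_dotProduct_sub (a', b) w.2 yp ym 0 0
  have hslice (xp xm : Fin k → Fin m → ℚ_[p]) :
      ∑ s, Bform p k (tupleSlice xp xm s) (tupleSlice 0 0 s) = 0 := by
    simp [Bform, tupleSlice]
  rw [hslice] at h₁ h₂
  rw [hrep, dotProduct_sub, dotProduct_sub, hηM, hξM, hξ, hη] at hlt
  have heq : glue b' xm ⬝ᵥ glue w.1.1 0 - glue b ym ⬝ᵥ glue w.2.1 0 +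
      (glue a' yp ⬝ᵥ glue w.2.2 0 - glue a xp ⬝ᵥ glue w.1.2 0) =
        -Bminus p α ((a, b'), (a', b)) w := by
    rw [Bminus]
    linear_combination h₂ - h₁
  rw [heq, norm_neg] at hlt
  exact hlt.not_ge (hw _ hz)

theorem isAlmostSelfDual_chiM (M : Matrix (BigIx α k m) (BigIx α k m) ℚ_[p])
    {Q T : Set (SpV p k)} (hQ : IsAlmostSelfDual p (Bform p k) Q)
    (hT : IsAlmostSelfDual p (Bform p k) T) :
    IsAlmostSelfDual p (Bminus p α) (chiM p α k m M Q T) := by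
  obtain ⟨⟨S, hSQ, hS⟩, hQp⟩ := hQ
  obtain ⟨⟨R, hRT, hR⟩, hTp⟩ := hT
  exact ⟨⟨chiM p α k m M S R, chiM_mono M hSQ hRT, isSelfDual_chiM M hS hR⟩,
    fun v hv w hw => norm_Bminus_le M p.cast_nonneg hQp hTp hv hw⟩

end Forms

/-- **The characteristic function is a morphism of the oriented graphs of almost self-dual
modules:** if `Q' ⊆ Q` and `T' ⊆ T` are almost self-dual `ℤ_p`-submodules of `H`, then
`χ_g(Q', T') ⊆ χ_g(Q, T)`, and both are almost self-dual submodules of `(V ⊕ V, B^⊖)`. -/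
theorem chi_graph_morphism (p : ℕ) [Fact p.Prime] (α k m : ℕ) (hk : 1 ≤ k) (hm : 1 ≤ m)
    (M : Matrix (BigIx α k m) (BigIx α k m) ℚ_[p]) (hM : IsUnit M)
    (Q Q' T T' : Set (SpV p k))
    (hQmod : IsZpSubmodule p Q) (hQ'mod : IsZpSubmodule p Q')
    (hTmod : IsZpSubmodule p T) (hT'mod : IsZpSubmodule p T')
    (hQ : IsAlmostSelfDual p (Bform p k) Q) (hQ' : IsAlmostSelfDual p (Bform p k) Q')
    (hT : IsAlmostSelfDual p (Bform p k) T) (hT' : IsAlmostSelfDual p (Bform p k) T')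
    (hQQ : Q' ⊆ Q) (hTT : T' ⊆ T) :
    chiM p α k m M Q' T' ⊆ chiM p α k m M Q T ∧
    IsAlmostSelfDual p (Bminus p α) (chiM p α k m M Q' T') ∧
    IsAlmostSelfDual p (Bminus p α) (chiM p α k m M Q T) := by
  exact ⟨chiM_mono M hQQ hTT, isAlmostSelfDual_chiM M hQ' hT', isAlmostSelfDual_chiM M hQ hT⟩
end

section
/- Involution: for every g ∈ GL(α+km, ℚ_p) and all ℤ_p-submodules Q, T ⊆ H, one has u ⊕ v ∈ χ_g(Q,T) if and only if v ⊕ u ∈ χ_{g^{-1}}(T,Q), where u, v ∈ V. -/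
open scoped BigOperators

/-- **Involution:** for every `g ∈ GL(α + km, ℚ_p)` (with inverse `g⁻¹`) and all
`ℤ_p`-submodules `Q, T ⊆ H`: `u ⊕ v ∈ χ_g(Q, T)` if and only if `v ⊕ u ∈ χ_{g⁻¹}(T, Q)`. -/
theorem chi_involution (p : ℕ) [Fact p.Prime] (α k m : ℕ) (hk : 1 ≤ k) (hm : 1 ≤ m)
    (M M' : Matrix (BigIx α k m) (BigIx α k m) ℚ_[p])
    (hMM' : M * M' = 1) (hM'M : M' * M = 1)
    (Q T : Set (SpV p k)) (hQ : IsZpSubmodule p Q) (hT : IsZpSubmodule p T)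
    (u v : SpV p α) :
    (u, v) ∈ chiM p α k m M Q T ↔ (v, u) ∈ chiM p α k m M' T Q := by
  have mulVec_eq_iff {A B : Matrix (BigIx α k m) (BigIx α k m) ℚ_[p]}
      (hAB : A * B = 1) (hBA : B * A = 1) (x y : BigIx α k m → ℚ_[p]) :
      y = A.mulVec x ↔ x = B.mulVec y := by
    constructor <;> rintro rfl <;> simp [Matrix.mulVec_mulVec, hAB, hBA]
  have hT₁ : M.transpose * M'.transpose = 1 := by
    rw [← Matrix.transpose_mul, hM'M, Matrix.transpose_one]
  have hT₂ : M'.transpose * M.transpose = 1 := by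
    rw [← Matrix.transpose_mul, hMM', Matrix.transpose_one]
  constructor
  · rintro ⟨xp, xm, yp, ym, hx, hy, hp, hm⟩
    exact ⟨yp, ym, xp, xm, hy, hx, (mulVec_eq_iff hMM' hM'M _ _).1 hp,
      (mulVec_eq_iff hT₁ hT₂ _ _).1 hm⟩
  · rintro ⟨yp, ym, xp, xm, hy, hx, hp, hm⟩
    exact ⟨xp, xm, yp, ym, hx, hy, (mulVec_eq_iff hM'M hMM' _ _).1 hp,
      (mulVec_eq_iff hT₂ hT₁ _ _).1 hm⟩
end

section
/- Additional symmetry: for λ ∈ ℚ_p^×, define M_H(λ) : H → H by (ξ⁺, ξ⁻) ↦ (λξ⁺, λ^{−1}ξ⁻) and M_V(λ) : V → V by (u⁺, u⁻) ↦ (λu⁺, λ^{−1}u⁻). Then for every g ∈ GL(α+km, ℚ_p) and all ℤ_p-submodules Q, T ⊆ H: χ_g(M_H(λ)Q, M_H(λ)T) = {M_V(λ)u ⊕ M_V(λ)v : u ⊕ v ∈ χ_g(Q,T)}. -/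
open scoped BigOperators

/-- The operator `M(λ) : (ξ⁺, ξ⁻) ↦ (λ ξ⁺, λ⁻¹ ξ⁻)` on a symplectic coordinate space. -/
noncomputable def Mlambda (p n : ℕ) [Fact p.Prime] (lam : ℚ_[p]) (x : SpV p n) : SpV p n :=
  (lam • x.1, lam⁻¹ • x.2)

theorem glue_smul {p α k m : ℕ} [Fact p.Prime] (c : ℚ_[p]) (u : Fin α → ℚ_[p])
    (x : Fin k → Fin m → ℚ_[p]) :
    (glue (c • u) (c • x) : BigIx α k m → ℚ_[p]) = c • glue u x := by
  ext i
  cases i <;> rfl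

theorem Mlambda_inv_Mlambda {p n : ℕ} [Fact p.Prime] {lam : ℚ_[p]} (hlam : lam ≠ 0)
    (x : SpV p n) : Mlambda p n lam⁻¹ (Mlambda p n lam x) = x := by
  ext <;> simp [Mlambda, hlam]

theorem Mlambda_Mlambda_inv {p n : ℕ} [Fact p.Prime] {lam : ℚ_[p]} (hlam : lam ≠ 0)
    (x : SpV p n) : Mlambda p n lam (Mlambda p n lam⁻¹ x) = x := by
  ext <;> simp [Mlambda, hlam]

theorem Mlambda_inv_image_image {p n : ℕ} [Fact p.Prime] {lam : ℚ_[p]} (hlam : lam ≠ 0)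
    (P : Set (SpV p n)) : Mlambda p n lam⁻¹ '' (Mlambda p n lam '' P) = P := by
  simp [Set.image_image, Mlambda_inv_Mlambda hlam]

theorem Mlambda_mem_chiM {p α k m : ℕ} [Fact p.Prime]
    {M : Matrix (BigIx α k m) (BigIx α k m) ℚ_[p]} {Q T : Set (SpV p k)} (lam : ℚ_[p])
    {uv : SpV p α × SpV p α} (h : uv ∈ chiM p α k m M Q T) :
    (Mlambda p α lam uv.1, Mlambda p α lam uv.2) ∈
      chiM p α k m M (Mlambda p k lam '' Q) (Mlambda p k lam '' T) := by
  obtain ⟨xp, xm, yp, ym, hx, hy, h₁, h₂⟩ := h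
  refine ⟨lam • xp, lam⁻¹ • xm, lam • yp, lam⁻¹ • ym, fun s => ⟨_, hx s, rfl⟩,
    fun s => ⟨_, hy s, rfl⟩, ?_, ?_⟩
  · simp only [Mlambda, glue_smul, Matrix.mulVec_smul, h₁]
  · simp only [Mlambda, glue_smul, Matrix.mulVec_smul, h₂]

/-- **Additional symmetry:** for `λ ∈ ℚ_p^×`, every `g ∈ GL(α + km, ℚ_p)` and all
`ℤ_p`-submodules `Q, T ⊆ H`:
`χ_g(M_H(λ) Q, M_H(λ) T) = {M_V(λ) u ⊕ M_V(λ) v : u ⊕ v ∈ χ_g(Q, T)}`. -/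
theorem chi_additional_symmetry (p : ℕ) [Fact p.Prime] (α k m : ℕ) (hk : 1 ≤ k) (hm : 1 ≤ m)
    (M : Matrix (BigIx α k m) (BigIx α k m) ℚ_[p]) (hM : IsUnit M)
    (Q T : Set (SpV p k)) (hQ : IsZpSubmodule p Q) (hT : IsZpSubmodule p T)
    (lam : ℚ_[p]) (hlam : lam ≠ 0) :
    chiM p α k m M (Mlambda p k lam '' Q) (Mlambda p k lam '' T) =
      (fun uv : SpV p α × SpV p α => (Mlambda p α lam uv.1, Mlambda p α lam uv.2)) ''
        chiM p α k m M Q T := by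
  refine Set.Subset.antisymm (fun uv h => ?_) ?_
  · refine ⟨(Mlambda p α lam⁻¹ uv.1, Mlambda p α lam⁻¹ uv.2), ?_, ?_⟩
    · simpa only [Mlambda_inv_image_image hlam] using Mlambda_mem_chiM lam⁻¹ h
    · simp only [Mlambda_Mlambda_inv hlam]
  · rintro _ ⟨uv, h, rfl⟩
    exact Mlambda_mem_chiM lam h
end
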